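/- arXiv:1903.11045 — 3 statements merged into one kernel-verified Lean document; each statement's English description precedes it below -/
import Mathlib

section
/- Let A = fromBlocks A_II A_IB A_BI A_BB be a 2×2 block matrix over a field with A_II invertible, let P = [−A_II⁻¹ · A_IB ; 1] be the ideal prolongation, Q = [−A_BI · A_II⁻¹ , 1] the ideal restriction, S = A_BB − A_BI · A_II⁻¹ · A_IB the Schur complement (assumed invertible), and G = fromBlocks A_II⁻¹ 0 0 0. Then the error propagation operator of the two-level method with ideal coarse grid correction followed by one F-smoothing step vanishes identically: (1 − G · A) · (1 − P · S⁻¹ · Q · A) = 0. -/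
open Matrix

/-- The error propagation operator of the two-level method with ideal coarse grid
correction followed by one F-smoothing step vanishes identically:
`(1 - G A)(1 - P S⁻¹ Q A) = 0`. -/
theorem stmt_5 {I B K : Type*} [Fintype I] [Fintype B] [DecidableEq I] [DecidableEq B]
    [Field K]
    (A_II : Matrix I I K) (A_IB : Matrix I B K) (A_BI : Matrix B I K) (A_BB : Matrix B B K)
    (hAII : IsUnit A_II.det)
    (S : Matrix B B K) (hS : S = A_BB - A_BI * A_II⁻¹ * A_IB)
    (hSu : IsUnit S.det)
    (P : Matrix (I ⊕ B) B K)
    (hP : P = Matrix.of (Sum.elim (fun i j => (-(A_II⁻¹ * A_IB)) i j)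
        (fun b j => (1 : Matrix B B K) b j)))
    (Q : Matrix B (I ⊕ B) K)
    (hQ : Q = Matrix.of (fun b => Sum.elim (fun i => (-(A_BI * A_II⁻¹)) b i)
        (fun b' => (1 : Matrix B B K) b b')))
    (G : Matrix (I ⊕ B) (I ⊕ B) K)
    (hG : G = Matrix.fromBlocks A_II⁻¹ 0 0 0)
    (A : Matrix (I ⊕ B) (I ⊕ B) K)
    (hA : A = Matrix.fromBlocks A_II A_IB A_BI A_BB) :
    (1 - G * A) * (1 - P * S⁻¹ * Q * A) = 0 := by
  have hP' : P = fromRows (-(A_II⁻¹ * A_IB)) 1 := by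
    rw [hP]
    ext (i | b) j <;> rfl
  have hQ' : Q = fromCols (-(A_BI * A_II⁻¹)) 1 := by
    rw [hQ]
    ext b (i | b') <;> rfl
  have hQA : Q * A = fromCols 0 S := by
    rw [hQ', hA, fromCols_mul_fromBlocks, hS]
    congr 1
    · rw [Matrix.neg_mul, Matrix.mul_assoc, nonsing_inv_mul _ hAII, Matrix.mul_one,
        Matrix.one_mul, neg_add_cancel]
    · rw [Matrix.neg_mul, Matrix.one_mul, neg_add_eq_sub]
  have hPSQA : P * S⁻¹ * Q * A = fromBlocks 0 (-(A_II⁻¹ * A_IB)) 0 1 := by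
    rw [Matrix.mul_assoc, hQA, Matrix.mul_assoc, mul_fromCols, nonsing_inv_mul _ hSu,
      Matrix.mul_zero, hP', fromRows_mul_fromCols]
    simp
  have hGA : G * A = fromBlocks 1 (A_II⁻¹ * A_IB) 0 0 := by
    rw [hG, hA, fromBlocks_multiply, nonsing_inv_mul _ hAII]
    simp
  rw [hPSQA, hGA, ← fromBlocks_one, sub_eq_add_neg, sub_eq_add_neg, fromBlocks_neg,
    fromBlocks_neg, fromBlocks_add, fromBlocks_add, fromBlocks_multiply]
  simp
end

section
/- Serial memory complexity of the (enriched) multilevel algorithm in 2D: for every natural number N ≥ 1 and all reals q > 0 and α ≥ 1, the total memory of the EML algorithm on a 2^N × 2^N grid, namely 16 · q² · (4^{N−1} · 1² + α² · Σ_{k=2}^{N} 4^{N−k}), evaluates exactly to 16 · q² · ((1/4) · (1 + α²/3) · 4^N − α²/3). Equivalently, with N_T = 4^N, the memory is O(α² q² N_T), linear in the number of elements (in contrast to the O(q² N_T log₂ N_T) memory of 2D nested dissection). -/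
open Finset

theorem sum_Icc_two_pow_sub {K : Type*} [CommRing K] (x : K) (n : ℕ) :
    (x - 1) * ∑ k ∈ Finset.Icc 2 (n + 1), x ^ (n + 1 - k) = x ^ n - 1 := by
  induction n with
  | zero => simp
  | succ n ih =>
    have h : ∑ k ∈ Finset.Icc 2 (n + 1), x ^ (n + 1 + 1 - k)
        = x * ∑ k ∈ Finset.Icc 2 (n + 1), x ^ (n + 1 - k) := by
      rw [Finset.mul_sum]
      refine Finset.sum_congr rfl fun k hk => ?_
      rw [Nat.sub_add_comm (Finset.mem_Icc.mp hk).2, pow_succ']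
    rw [Finset.sum_Icc_succ_top (by lia), h, Nat.sub_self, pow_zero]
    linear_combination x * ih

/-- 2D (enriched) multilevel memory cost: with enrichment ratio `α₁ = 1` at level 1
and `α` at all coarser levels,
`16 q² (4^{N−1}·1² + α² Σ_{k=2}^{N} 4^{N−k}) = 16 q² ((1/4)(1 + α²/3) 4^N − α²/3)`,
i.e. `O(α² q² N_T)` with `N_T = 4^N`. -/
theorem stmt_11 (N : ℕ) (hN : 1 ≤ N) (q α : ℝ) (hq : 0 < q) (hα : 1 ≤ α) :
    16 * q ^ 2 * ((4 : ℝ) ^ (N - 1) * 1 ^ 2 +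
        α ^ 2 * ∑ k ∈ Finset.Icc 2 N, (4 : ℝ) ^ (N - k))
      = 16 * q ^ 2 * ((1 / 4) * (1 + α ^ 2 / 3) * 4 ^ N - α ^ 2 / 3) := by
  obtain ⟨n, rfl⟩ := Nat.exists_eq_add_of_le' hN
  have h := sum_Icc_two_pow_sub (4 : ℝ) n
  rw [Nat.add_sub_cancel, pow_succ (4 : ℝ) n]
  linear_combination 16 * q ^ 2 * α ^ 2 / 3 * h
end

section
/- Serial memory complexity of the (enriched) multilevel algorithm in 3D: for every natural number N ≥ 1 and all reals q > 0 and α ≥ 1, the total memory of the EML algorithm on a 2^N × 2^N × 2^N grid, namely 144 · q² · (8^{N−1} · 1² + α² · Σ_{k=2}^{N} 8^{N−k}), evaluates exactly to 144 · q² · ((1/8) · (1 + α²/7) · 8^N − α²/7). Equivalently, with N_T = 8^N, the memory is O(α² q² N_T), linear in the number of elements (in contrast to the O(q² N_T^{4/3}) memory of 3D nested dissection). -/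
open Finset

/-- The geometric sum of `8 ^ (n + 1 - k)` over the levels `k = 2, …, n + 1`. -/
theorem sum_Icc_two_eight_pow (n : ℕ) :
    ∑ k ∈ Finset.Icc 2 (n + 1), (8 : ℝ) ^ (n + 1 - k) = (8 ^ n - 1) / 7 := by
  induction n with
  | zero => simp
  | succ n ih =>
    have h : ∑ k ∈ Finset.Icc 2 (n + 1), (8 : ℝ) ^ (n + 1 + 1 - k)
        = 8 * ∑ k ∈ Finset.Icc 2 (n + 1), (8 : ℝ) ^ (n + 1 - k) := by
      rw [Finset.mul_sum]
      refine Finset.sum_congr rfl fun k hk => ?_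
      rw [Nat.sub_add_comm (Finset.mem_Icc.mp hk).2, pow_succ']
    rw [Finset.sum_Icc_succ_top (by omega), h, ih, Nat.sub_self]
    ring

/-- 3D (enriched) multilevel memory cost: with enrichment ratio `α₁ = 1` at level 1
and `α` at all coarser levels,
`144 q² (8^{N−1}·1² + α² Σ_{k=2}^{N} 8^{N−k}) = 144 q² ((1/8)(1 + α²/7) 8^N − α²/7)`,
i.e. `O(α² q² N_T)` with `N_T = 8^N`. -/
theorem stmt_13 (N : ℕ) (hN : 1 ≤ N) (q α : ℝ) (hq : 0 < q) (hα : 1 ≤ α) :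
    144 * q ^ 2 * ((8 : ℝ) ^ (N - 1) * 1 ^ 2 +
        α ^ 2 * ∑ k ∈ Finset.Icc 2 N, (8 : ℝ) ^ (N - k))
      = 144 * q ^ 2 * ((1 / 8) * (1 + α ^ 2 / 7) * 8 ^ N - α ^ 2 / 7) := by
  obtain ⟨n, rfl⟩ := Nat.exists_eq_add_of_le' hN
  rw [sum_Icc_two_eight_pow, Nat.add_sub_cancel]
  ring
end
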